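/- arXiv:2010.12094 — 6 statements merged into one kernel-verified Lean document; each statement's English description precedes it below -/
import Mathlib

section
/- For every n ≥ 0, the function ρₙ is concave on [0,∞)³: for all z, z' ∈ [0,∞)³ and t ∈ [0,1], ρₙ(t z + (1−t) z') ≥ t ρₙ(z) + (1−t) ρₙ(z'). -/
open MeasureTheory

open Filter Topology

/-- A nonnegative concave function of three variables in `[0,∞)`. -/
structure OctantConcave (f : ℝ → ℝ → ℝ → ℝ) : Prop where
  nonneg : ∀ a b c : ℝ, 0 ≤ a → 0 ≤ b → 0 ≤ c → 0 ≤ f a b c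
  concave : ∀ z₀ z₁ z₂ w₀ w₁ w₂ t : ℝ, 0 ≤ z₀ → 0 ≤ z₁ → 0 ≤ z₂ → 0 ≤ w₀ → 0 ≤ w₁ → 0 ≤ w₂ →
    0 ≤ t → t ≤ 1 → t * f z₀ z₁ z₂ + (1 - t) * f w₀ w₁ w₂ ≤
      f (t * z₀ + (1 - t) * w₀) (t * z₁ + (1 - t) * w₁) (t * z₂ + (1 - t) * w₂)

namespace OctantConcave

variable {f : ℝ → ℝ → ℝ → ℝ}

theorem smul_le (hf : OctantConcave f) {s a b c a' b' c' : ℝ} (hs0 : 0 ≤ s) (hs1 : s < 1)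
    (ha : 0 ≤ a) (hb : 0 ≤ b) (hc : 0 ≤ c) (haa : s * a ≤ a') (hbb : s * b ≤ b')
    (hcc : s * c ≤ c') : s * f a b c ≤ f a' b' c' := by
  have h1 : 0 < 1 - s := by linarith
  have e (u v : ℝ) : s * u + (1 - s) * ((v - s * u) / (1 - s)) = v := by
    field_simp; ring
  have n {u v : ℝ} (h : s * u ≤ v) : 0 ≤ (v - s * u) / (1 - s) :=
    div_nonneg (by linarith) h1.le
  have key := hf.concave a b c _ _ _ s ha hb hc (n haa) (n hbb) (n hcc) hs0 hs1.le
  rw [e, e, e] at key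
  have := mul_nonneg h1.le (hf.nonneg _ _ _ (n haa) (n hbb) (n hcc))
  linarith

theorem lowerSemicontinuous (hf : OctantConcave f) :
    LowerSemicontinuous fun z : ℝ × ℝ × ℝ => f (max 0 z.1) (max 0 z.2.1) (max 0 z.2.2) := by
  intro z y hy
  have hlim : Tendsto (fun s : ℝ => s * f (max 0 z.1) (max 0 z.2.1) (max 0 z.2.2)) (𝓝[<] 1)
      (𝓝 (f (max 0 z.1) (max 0 z.2.1) (max 0 z.2.2))) := by
    have : Continuous fun s : ℝ => s * f (max 0 z.1) (max 0 z.2.1) (max 0 z.2.2) := by fun_prop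
    simpa using (this.tendsto 1).mono_left nhdsWithin_le_nhds
  obtain ⟨s, hys, hs0, hs1⟩ :=
    ((hlim.eventually_const_lt hy).and (Ioo_mem_nhdsLT (show (0 : ℝ) < 1 by norm_num))).exists
  have near (φ : ℝ × ℝ × ℝ → ℝ) (hφ : Continuous φ) :
      ∀ᶠ z' in 𝓝 z, s * max 0 (φ z) ≤ max 0 (φ z') := by
    rcases (le_max_left 0 (φ z)).eq_or_lt with h | h
    · filter_upwards with z'
      rw [← h, mul_zero]
      exact le_max_left _ _
    · have hcont : Continuous fun z' => max 0 (φ z') := by fun_prop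
      have hlt : s * max 0 (φ z) < max 0 (φ z) := by nlinarith
      exact ((hcont.tendsto z).eventually_const_lt hlt).mono fun _ h => h.le
  filter_upwards [near (fun z => z.1) (by fun_prop), near (fun z => z.2.1) (by fun_prop),
    near (fun z => z.2.2) (by fun_prop)] with z' h0 h1 h2
  exact hys.trans_le (hf.smul_le hs0.le hs1 (le_max_left _ _) (le_max_left _ _) (le_max_left _ _)
    h0 h1 h2)

variable {X : Type*} [MeasurableSpace X]

theorem measurable_comp (hf : OctantConcave f) {a b c : X → ℝ} (ha : Measurable a)
    (hb : Measurable b) (hc : Measurable c) (ha0 : ∀ x, 0 ≤ a x) (hb0 : ∀ x, 0 ≤ b x)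
    (hc0 : ∀ x, 0 ≤ c x) : Measurable fun x => f (a x) (b x) (c x) := by
  have h := hf.lowerSemicontinuous.measurable.comp (ha.prodMk (hb.prodMk hc))
  simpa [Function.comp_def, max_eq_right (ha0 _), max_eq_right (hb0 _), max_eq_right (hc0 _)]
    using h

theorem min {g : ℝ → ℝ → ℝ → ℝ} (hf : OctantConcave f) (hg : OctantConcave g) :
    OctantConcave fun a b c => Min.min (f a b c) (g a b c) where
  nonneg a b c ha hb hc := le_min (hf.nonneg a b c ha hb hc) (hg.nonneg a b c ha hb hc)
  concave z₀ z₁ z₂ w₀ w₁ w₂ t h0 h1 h2 k0 k1 k2 ht0 ht1 := by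
    refine le_min (le_trans ?_ (hf.concave z₀ z₁ z₂ w₀ w₁ w₂ t h0 h1 h2 k0 k1 k2 ht0 ht1))
      (le_trans ?_ (hg.concave z₀ z₁ z₂ w₀ w₁ w₂ t h0 h1 h2 k0 k1 k2 ht0 ht1)) <;>
    refine add_le_add (mul_le_mul_of_nonneg_left ?_ ht0)
      (mul_le_mul_of_nonneg_left ?_ (sub_nonneg.2 ht1))
    exacts [min_le_left _ _, min_le_left _ _, min_le_right _ _, min_le_right _ _]

theorem congr {g : ℝ → ℝ → ℝ → ℝ} (hf : OctantConcave f)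
    (hfg : ∀ a b c, 0 ≤ a → 0 ≤ b → 0 ≤ c → g a b c = f a b c) : OctantConcave g where
  nonneg a b c ha hb hc := (hf.nonneg a b c ha hb hc).trans_eq (hfg a b c ha hb hc).symm
  concave z₀ z₁ z₂ w₀ w₁ w₂ t h0 h1 h2 k0 k1 k2 ht0 ht1 := by
    have ht1' : 0 ≤ 1 - t := sub_nonneg.2 ht1
    rw [hfg _ _ _ h0 h1 h2, hfg _ _ _ k0 k1 k2,
      hfg _ _ _ (by positivity) (by positivity) (by positivity)]
    exact hf.concave z₀ z₁ z₂ w₀ w₁ w₂ t h0 h1 h2 k0 k1 k2 ht0 ht1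

theorem min_mul {l₁ l₂ : ℝ} (hl₁ : 0 ≤ l₁) (hl₂ : 0 ≤ l₂) :
    OctantConcave fun _ z₁ z₂ => Min.min (l₁ * z₁) (l₂ * z₂) :=
  min (f := fun _ z₁ _ => l₁ * z₁) (g := fun _ _ z₂ => l₂ * z₂)
    ⟨fun _ _ _ _ hb _ => mul_nonneg hl₁ hb, fun _ _ _ _ _ _ _ _ _ _ _ _ _ _ _ => by
      apply le_of_eq; ring⟩
    ⟨fun _ _ _ _ _ hc => mul_nonneg hl₂ hc, fun _ _ _ _ _ _ _ _ _ _ _ _ _ _ _ => by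
      apply le_of_eq; ring⟩

/-- Concavity is preserved by adding `z₀` to the optimal expected continuation value. -/
theorem add_sSup_integral (hf : OctantConcave f) {μ : Measure X} {p₁ p₂ : X → ℝ}
    (hp₁m : Measurable p₁) (hp₂m : Measurable p₂)
    (hp₁0 : ∀ x, 0 ≤ p₁ x) (hp₂0 : ∀ x, 0 ≤ p₂ x) (hp₁1 : ∫ x, p₁ x ∂μ = 1) {l : ℝ}
    (hfl : ∀ a b c, 0 ≤ a → 0 ≤ b → 0 ≤ c → f a b c ≤ l * b) :
    OctantConcave fun z₀ z₁ z₂ =>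
      z₀ + sSup {d : ℝ | ∃ p₀ : X → ℝ, Measurable p₀ ∧ (∀ x, 0 ≤ p₀ x) ∧
        (∫ x, p₀ x ∂μ) = 1 ∧ d = ∫ x, f (z₀ * p₀ x) (z₁ * p₁ x) (z₂ * p₂ x) ∂μ} := by
  have hi {p : X → ℝ} (hp : ∫ x, p x ∂μ = 1) : Integrable p μ :=
    Integrable.of_integral_ne_zero (by rw [hp]; exact one_ne_zero)
  have hint {a : X → ℝ} {z₁ z₂ : ℝ} (ha : Measurable a) (ha0 : ∀ x, 0 ≤ a x) (h1 : 0 ≤ z₁)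
      (h2 : 0 ≤ z₂) : Integrable (fun x => f (a x) (z₁ * p₁ x) (z₂ * p₂ x)) μ := by
    refine (((hi hp₁1).const_mul z₁).const_mul l).mono'
      (hf.measurable_comp ha (hp₁m.const_mul z₁) (hp₂m.const_mul z₂) ha0
        (fun x => mul_nonneg h1 (hp₁0 x)) fun x => mul_nonneg h2 (hp₂0 x)).aestronglyMeasurable
      (ae_of_all _ fun x => ?_)
    have hb := mul_nonneg h1 (hp₁0 x)
    have hc := mul_nonneg h2 (hp₂0 x)
    rw [Real.norm_of_nonneg (hf.nonneg _ _ _ (ha0 x) hb hc)]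
    exact hfl _ _ _ (ha0 x) hb hc
  have hbdd {z₀ z₁ z₂ : ℝ} (h0 : 0 ≤ z₀) (h1 : 0 ≤ z₁) (h2 : 0 ≤ z₂) :
      BddAbove {d : ℝ | ∃ p₀ : X → ℝ, Measurable p₀ ∧ (∀ x, 0 ≤ p₀ x) ∧
        (∫ x, p₀ x ∂μ) = 1 ∧ d = ∫ x, f (z₀ * p₀ x) (z₁ * p₁ x) (z₂ * p₂ x) ∂μ} := by
    refine ⟨∫ x, l * (z₁ * p₁ x) ∂μ, ?_⟩
    rintro _ ⟨p₀, hm, hn, -, rfl⟩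
    exact integral_mono (hint (hm.const_mul z₀) (fun x => mul_nonneg h0 (hn x)) h1 h2)
      (((hi hp₁1).const_mul z₁).const_mul l) fun x =>
        hfl _ _ _ (mul_nonneg h0 (hn x)) (mul_nonneg h1 (hp₁0 x)) (mul_nonneg h2 (hp₂0 x))
  have hne (z₀ z₁ z₂ : ℝ) : {d : ℝ | ∃ p₀ : X → ℝ, Measurable p₀ ∧ (∀ x, 0 ≤ p₀ x) ∧
      (∫ x, p₀ x ∂μ) = 1 ∧ d = ∫ x, f (z₀ * p₀ x) (z₁ * p₁ x) (z₂ * p₂ x) ∂μ}.Nonempty :=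
    ⟨_, p₁, hp₁m, hp₁0, hp₁1, rfl⟩
  constructor
  · intro z₀ z₁ z₂ h0 h1 h2
    refine add_nonneg h0 (Real.sSup_nonneg ?_)
    rintro _ ⟨p₀, hm, hn, -, rfl⟩
    exact integral_nonneg fun x => hf.nonneg _ _ _ (mul_nonneg h0 (hn x))
      (mul_nonneg h1 (hp₁0 x)) (mul_nonneg h2 (hp₂0 x))
  intro z₀ z₁ z₂ w₀ w₁ w₂ t h0 h1 h2 k0 k1 k2 ht0 ht1
  have ht1' : 0 ≤ 1 - t := sub_nonneg.2 ht1
  have hy0 : 0 ≤ t * z₀ + (1 - t) * w₀ := by positivity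
  have hy1 : 0 ≤ t * z₁ + (1 - t) * w₁ := by positivity
  have hy2 : 0 ≤ t * z₂ + (1 - t) * w₂ := by positivity
  have hmix {q r : X → ℝ} (hqm : Measurable q) (hq0 : ∀ x, 0 ≤ q x) (hq1 : ∫ x, q x ∂μ = 1)
      (hrm : Measurable r) (hr0 : ∀ x, 0 ≤ r x) (hr1 : ∫ x, r x ∂μ = 1) :
      ∃ p : X → ℝ, Measurable p ∧ (∀ x, 0 ≤ p x) ∧ ∫ x, p x ∂μ = 1 ∧
        ∀ x, (t * z₀ + (1 - t) * w₀) * p x = t * (z₀ * q x) + (1 - t) * (w₀ * r x) := by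
    rcases hy0.eq_or_lt with h | h
    · have hz : t * z₀ = 0 := by nlinarith [mul_nonneg ht0 h0, mul_nonneg ht1' k0]
      have hw : (1 - t) * w₀ = 0 := by linarith
      exact ⟨q, hqm, hq0, hq1, fun x => by rw [← mul_assoc, ← mul_assoc, hz, hw]; ring⟩
    · refine ⟨fun x => (t * z₀ * q x + (1 - t) * w₀ * r x) / (t * z₀ + (1 - t) * w₀),
        by fun_prop, fun x => ?_, ?_, fun x => ?_⟩
      · have := hq0 x
        have := hr0 x
        positivity
      · rw [integral_div, integral_add ((hi hq1).const_mul _) ((hi hr1).const_mul _),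
          integral_const_mul, integral_const_mul, hq1, hr1, mul_one, mul_one, div_self h.ne']
      · rw [mul_div_cancel₀ _ h.ne']
        ring
  suffices h : ∀ ε : ℝ, 0 < ε → _ ≤ _ + ε from le_of_forall_pos_le_add h
  intro ε hε
  obtain ⟨_, ⟨q, hqm, hq0, hq1, rfl⟩, hq⟩ :=
    exists_lt_of_lt_csSup (hne z₀ z₁ z₂) (sub_lt_self _ hε)
  obtain ⟨_, ⟨r, hrm, hr0, hr1, rfl⟩, hr⟩ :=
    exists_lt_of_lt_csSup (hne w₀ w₁ w₂) (sub_lt_self _ hε)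
  obtain ⟨p, hpm, hp0, hp1, hp⟩ := hmix hqm hq0 hq1 hrm hr0 hr1
  have hle := le_csSup (hbdd hy0 hy1 hy2) ⟨p, hpm, hp0, hp1, rfl⟩
  have hqi := hint (hqm.const_mul z₀) (fun x => mul_nonneg h0 (hq0 x)) h1 h2
  have hri := hint (hrm.const_mul w₀) (fun x => mul_nonneg k0 (hr0 x)) k1 k2
  have hI : t * ∫ x, f (z₀ * q x) (z₁ * p₁ x) (z₂ * p₂ x) ∂μ +
      (1 - t) * ∫ x, f (w₀ * r x) (w₁ * p₁ x) (w₂ * p₂ x) ∂μ ≤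
      ∫ x, f ((t * z₀ + (1 - t) * w₀) * p x) ((t * z₁ + (1 - t) * w₁) * p₁ x)
        ((t * z₂ + (1 - t) * w₂) * p₂ x) ∂μ := by
    rw [← integral_const_mul, ← integral_const_mul,
      ← integral_add (hqi.const_mul _) (hri.const_mul _)]
    refine integral_mono ((hqi.const_mul _).add (hri.const_mul _))
      (hint (hpm.const_mul _) (fun x => mul_nonneg hy0 (hp0 x)) hy1 hy2) fun x => ?_
    have key := hf.concave _ _ _ _ _ _ t (mul_nonneg h0 (hq0 x)) (mul_nonneg h1 (hp₁0 x))
      (mul_nonneg h2 (hp₂0 x)) (mul_nonneg k0 (hr0 x)) (mul_nonneg k1 (hp₁0 x))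
      (mul_nonneg k2 (hp₂0 x)) ht0 ht1
    have e (a b c : ℝ) : (t * a + (1 - t) * b) * c = t * (a * c) + (1 - t) * (b * c) := by ring
    simp only [hp, e]
    exact key
  have e1 := mul_le_mul_of_nonneg_left hq.le ht0
  have e2 := mul_le_mul_of_nonneg_left hr.le ht1'
  linarith

end OctantConcave

/-- For every `n ≥ 0`, the function `ρₙ` is concave on `[0,∞)³`:
for all `z, z' ∈ [0,∞)³` and `t ∈ [0,1]`,
`ρₙ(t z + (1−t) z') ≥ t ρₙ(z) + (1−t) ρₙ(z')`. -/
theorem rho_concave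
    {X : Type*} [MeasurableSpace X] (μ : Measure X) [SigmaFinite μ]
    (p₁ p₂ : X → ℝ) (hp₁m : Measurable p₁) (hp₂m : Measurable p₂)
    (hp₁0 : ∀ x, 0 ≤ p₁ x) (hp₂0 : ∀ x, 0 ≤ p₂ x)
    (hp₁1 : ∫ x, p₁ x ∂μ = 1) (hp₂1 : ∫ x, p₂ x ∂μ = 1)
    (l₁ l₂ : ℝ) (hl₁ : 0 < l₁) (hl₂ : 0 < l₂)
    (ρ : ℕ → ℝ → ℝ → ℝ → ℝ)
    (hρ0 : ∀ z₀ z₁ z₂ : ℝ, ρ 0 z₀ z₁ z₂ = min (l₁ * z₁) (l₂ * z₂))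
    (hρrec : ∀ (n : ℕ) (z₀ z₁ z₂ : ℝ), 0 ≤ z₀ → 0 ≤ z₁ → 0 ≤ z₂ →
      ρ (n + 1) z₀ z₁ z₂ =
        min (min (l₁ * z₁) (l₂ * z₂))
          (z₀ + sSup {d : ℝ | ∃ p₀ : X → ℝ, Measurable p₀ ∧ (∀ x, 0 ≤ p₀ x) ∧
            (∫ x, p₀ x ∂μ) = 1 ∧
            d = ∫ x, ρ n (z₀ * p₀ x) (z₁ * p₁ x) (z₂ * p₂ x) ∂μ})) :
    ∀ (n : ℕ) (z₀ z₁ z₂ w₀ w₁ w₂ t : ℝ),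
      0 ≤ z₀ → 0 ≤ z₁ → 0 ≤ z₂ →
      0 ≤ w₀ → 0 ≤ w₁ → 0 ≤ w₂ →
      0 ≤ t → t ≤ 1 →
      t * ρ n z₀ z₁ z₂ + (1 - t) * ρ n w₀ w₁ w₂ ≤
        ρ n (t * z₀ + (1 - t) * w₀) (t * z₁ + (1 - t) * w₁) (t * z₂ + (1 - t) * w₂) := by
  have hg := OctantConcave.min_mul hl₁.le hl₂.le
  have hle (n : ℕ) (a b c : ℝ) (ha : 0 ≤ a) (hb : 0 ≤ b) (hc : 0 ≤ c) : ρ n a b c ≤ l₁ * b := by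
    cases n with
    | zero => exact (hρ0 a b c).trans_le (min_le_left _ _)
    | succ n => exact (hρrec n a b c ha hb hc).trans_le ((min_le_left _ _).trans (min_le_left _ _))
  have hρ (n : ℕ) : OctantConcave (ρ n) := by
    induction n with
    | zero => exact hg.congr fun a b c _ _ _ => hρ0 a b c
    | succ n ih =>
      exact (hg.min (ih.add_sSup_integral hp₁m hp₂m hp₁0 hp₂0 hp₁1 (hle n))).congr
        fun a b c ha hb hc => hρrec n a b c ha hb hc
  exact fun n => (hρ n).concave
end

section
/- For every n ≥ 0, the function ρₙ is positively homogeneous of degree one: for all t ≥ 0 and z ∈ [0,∞)³, ρₙ(t z) = t ρₙ(z). -/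
open MeasureTheory
open scoped Pointwise

/-- For every `n ≥ 0`, the function `ρₙ` is positively homogeneous of degree
one: for all `t ≥ 0` and `z ∈ [0,∞)³`, `ρₙ(t z) = t ρₙ(z)`. -/
theorem rho_homogeneous
    {X : Type*} [MeasurableSpace X] (μ : Measure X) [SigmaFinite μ]
    (p₁ p₂ : X → ℝ) (hp₁m : Measurable p₁) (hp₂m : Measurable p₂)
    (hp₁0 : ∀ x, 0 ≤ p₁ x) (hp₂0 : ∀ x, 0 ≤ p₂ x)
    (hp₁1 : ∫ x, p₁ x ∂μ = 1) (hp₂1 : ∫ x, p₂ x ∂μ = 1)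
    (l₁ l₂ : ℝ) (hl₁ : 0 < l₁) (hl₂ : 0 < l₂)
    (ρ : ℕ → ℝ → ℝ → ℝ → ℝ)
    (hρ0 : ∀ z₀ z₁ z₂ : ℝ, ρ 0 z₀ z₁ z₂ = min (l₁ * z₁) (l₂ * z₂))
    (hρrec : ∀ (n : ℕ) (z₀ z₁ z₂ : ℝ), 0 ≤ z₀ → 0 ≤ z₁ → 0 ≤ z₂ →
      ρ (n + 1) z₀ z₁ z₂ =
        min (min (l₁ * z₁) (l₂ * z₂))
          (z₀ + sSup {d : ℝ | ∃ p₀ : X → ℝ, Measurable p₀ ∧ (∀ x, 0 ≤ p₀ x) ∧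
            (∫ x, p₀ x ∂μ) = 1 ∧
            d = ∫ x, ρ n (z₀ * p₀ x) (z₁ * p₁ x) (z₂ * p₂ x) ∂μ})) :
    ∀ (n : ℕ) (t z₀ z₁ z₂ : ℝ),
      0 ≤ t → 0 ≤ z₀ → 0 ≤ z₁ → 0 ≤ z₂ →
      ρ n (t * z₀) (t * z₁) (t * z₂) = t * ρ n z₀ z₁ z₂ := by
  intro n
  induction n with
  | zero =>
    intro t z₀ z₁ z₂ ht _ _ _
    rw [hρ0, hρ0, mul_min_of_nonneg _ _ ht, mul_left_comm l₁, mul_left_comm l₂]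
  | succ n ih =>
    intro t z₀ z₁ z₂ ht h₀ h₁ h₂
    have hint : ∀ p₀ : X → ℝ, (∀ x, 0 ≤ p₀ x) →
        ∫ x, ρ n (t * z₀ * p₀ x) (t * z₁ * p₁ x) (t * z₂ * p₂ x) ∂μ =
          t * ∫ x, ρ n (z₀ * p₀ x) (z₁ * p₁ x) (z₂ * p₂ x) ∂μ := by
      intro p₀ hp₀
      rw [← integral_const_mul]
      congr 1 with x
      rw [mul_assoc, mul_assoc, mul_assoc, ih t _ _ _ ht (mul_nonneg h₀ (hp₀ x))
        (mul_nonneg h₁ (hp₁0 x)) (mul_nonneg h₂ (hp₂0 x))]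
    rw [hρrec n _ _ _ (mul_nonneg ht h₀) (mul_nonneg ht h₁) (mul_nonneg ht h₂),
      hρrec n _ _ _ h₀ h₁ h₂, mul_min_of_nonneg _ _ ht, mul_min_of_nonneg _ _ ht, mul_add,
      mul_left_comm l₁, mul_left_comm l₂, ← smul_eq_mul t (sSup _),
      ← Real.sSup_smul_of_nonneg ht]
    congr 3
    ext d
    simp only [Set.mem_smul_set, Set.mem_ofPred_eq, smul_eq_mul]
    constructor
    · rintro ⟨p₀, hm, hp₀, h1, rfl⟩
      exact ⟨_, ⟨p₀, hm, hp₀, h1, rfl⟩, (hint p₀ hp₀).symm⟩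
    · rintro ⟨_, ⟨p₀, hm, hp₀, h1, rfl⟩, rfl⟩
      exact ⟨p₀, hm, hp₀, h1, (hint p₀ hp₀).symm⟩
end

section
/- The sequence (ρₙ)ₙ is pointwise nonincreasing in n, i.e. ρ_{n+1}(z) ≤ ρₙ(z) for all n ≥ 0 and z ∈ [0,∞)³; consequently the pointwise limit ρ(z) := limₙ ρₙ(z) exists for every z, and ρ is nonnegative, nondecreasing in each coordinate, concave on [0,∞)³, and satisfies ρ(z) ≤ min(λ₁ z₁, λ₂ z₂) for all z. -/
open MeasureTheory Filter

/-- A nonnegative monotone concave function on `[0,∞)³` bounded by `min (l₁ * z₁) (l₂ * z₂)`. -/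
structure IsRegularBound (l₁ l₂ : ℝ) (f : ℝ → ℝ → ℝ → ℝ) : Prop where
  nonneg : ∀ z₀ z₁ z₂ : ℝ, 0 ≤ z₀ → 0 ≤ z₁ → 0 ≤ z₂ → 0 ≤ f z₀ z₁ z₂
  le_min : ∀ z₀ z₁ z₂ : ℝ, 0 ≤ z₀ → 0 ≤ z₁ → 0 ≤ z₂ → f z₀ z₁ z₂ ≤ min (l₁ * z₁) (l₂ * z₂)
  mono : ∀ z₀ z₁ z₂ w₀ w₁ w₂ : ℝ, 0 ≤ z₀ → 0 ≤ z₁ → 0 ≤ z₂ →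
    z₀ ≤ w₀ → z₁ ≤ w₁ → z₂ ≤ w₂ → f z₀ z₁ z₂ ≤ f w₀ w₁ w₂
  concave : ∀ z₀ z₁ z₂ w₀ w₁ w₂ t : ℝ, 0 ≤ z₀ → 0 ≤ z₁ → 0 ≤ z₂ →
    0 ≤ w₀ → 0 ≤ w₁ → 0 ≤ w₂ → 0 ≤ t → t ≤ 1 →
    t * f z₀ z₁ z₂ + (1 - t) * f w₀ w₁ w₂ ≤
      f (t * z₀ + (1 - t) * w₀) (t * z₁ + (1 - t) * w₁) (t * z₂ + (1 - t) * w₂)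

theorem isRegularBound_min {l₁ l₂ : ℝ} (hl₁ : 0 ≤ l₁) (hl₂ : 0 ≤ l₂) :
    IsRegularBound l₁ l₂ (fun _ z₁ z₂ => min (l₁ * z₁) (l₂ * z₂)) where
  nonneg _ _ _ _ h₁ h₂ := le_min (mul_nonneg hl₁ h₁) (mul_nonneg hl₂ h₂)
  le_min _ _ _ _ _ _ := le_rfl
  mono _ _ _ _ _ _ _ _ _ _ h₁ h₂ := by gcongr
  concave _ z₁ z₂ _ w₁ w₂ t _ _ _ _ _ _ ht ht' := by
    have ht'' : 0 ≤ 1 - t := by linarith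
    refine _root_.le_min ?_ ?_
    · calc _ ≤ t * (l₁ * z₁) + (1 - t) * (l₁ * w₁) := by gcongr <;> exact min_le_left _ _
        _ = _ := by ring
    · calc _ ≤ t * (l₂ * z₂) + (1 - t) * (l₂ * w₂) := by gcongr <;> exact min_le_right _ _
        _ = _ := by ring

/-- A number close to `a` has positive part at least `t` times that of `a`, when `t < 1`. -/
theorem eventually_mul_max_zero_le {t : ℝ} (ht : t < 1) (a : ℝ) :
    ∀ᶠ b in nhds a, t * max a 0 ≤ max b 0 := by
  rcases le_or_gt a 0 with ha | ha
  · simp [max_eq_right ha]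
  · have h : t * a < a := by nlinarith
    filter_upwards [lt_mem_nhds h] with b hb
    rw [max_eq_left ha.le]
    exact hb.le.trans (le_max_left _ _)

namespace IsRegularBound

variable {l₁ l₂ : ℝ} {f : ℝ → ℝ → ℝ → ℝ}

theorem smul_le (hf : IsRegularBound l₁ l₂ f) {t z₀ z₁ z₂ : ℝ} (ht : 0 ≤ t) (ht' : t ≤ 1)
    (h₀ : 0 ≤ z₀) (h₁ : 0 ≤ z₁) (h₂ : 0 ≤ z₂) :
    t * f z₀ z₁ z₂ ≤ f (t * z₀) (t * z₁) (t * z₂) := by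
  have h := hf.concave z₀ z₁ z₂ 0 0 0 t h₀ h₁ h₂ le_rfl le_rfl le_rfl ht ht'
  have h' := mul_nonneg (sub_nonneg.2 ht') (hf.nonneg 0 0 0 le_rfl le_rfl le_rfl)
  simp only [mul_zero, add_zero] at h
  linarith

theorem lowerSemicontinuous (hf : IsRegularBound l₁ l₂ f) :
    LowerSemicontinuous fun z : ℝ × ℝ × ℝ => f (max z.1 0) (max z.2.1 0) (max z.2.2 0) := by
  rintro ⟨z₀, z₁, z₂⟩ a ha
  dsimp only at ha
  have hn₀ := le_max_right z₀ 0
  have hn₁ := le_max_right z₁ 0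
  have hn₂ := le_max_right z₂ 0
  obtain ⟨t, ht0, ht1, hat⟩ :
      ∃ t : ℝ, 0 ≤ t ∧ t < 1 ∧ a < t * f (max z₀ 0) (max z₁ 0) (max z₂ 0) := by
    rcases lt_or_ge a 0 with h | h
    · exact ⟨0, le_rfl, one_pos, by simpa using h⟩
    · have hpos := h.trans_lt ha
      obtain ⟨t, h1, h2⟩ := exists_between ((div_lt_one hpos).2 ha)
      exact ⟨t, (div_nonneg h hpos.le).trans h1.le, h2, (div_lt_iff₀ hpos).1 h1⟩
  have e₀ := (continuous_fst.tendsto (z₀, z₁, z₂)).eventually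
    (eventually_mul_max_zero_le ht1 z₀)
  have e₁ := ((continuous_fst.comp continuous_snd).tendsto (z₀, z₁, z₂)).eventually
    (eventually_mul_max_zero_le ht1 z₁)
  have e₂ := ((continuous_snd.comp continuous_snd).tendsto (z₀, z₁, z₂)).eventually
    (eventually_mul_max_zero_le ht1 z₂)
  filter_upwards [e₀, e₁, e₂] with w h₀ h₁ h₂
  exact hat.trans_le ((hf.smul_le ht0 ht1.le hn₀ hn₁ hn₂).trans
    (hf.mono _ _ _ _ _ _ (mul_nonneg ht0 hn₀) (mul_nonneg ht0 hn₁) (mul_nonneg ht0 hn₂) h₀ h₁ h₂))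

variable {X : Type*} [MeasurableSpace X] {q₀ q₁ q₂ : X → ℝ}

theorem measurable_comp (hf : IsRegularBound l₁ l₂ f) (hq₀ : Measurable q₀) (hq₁ : Measurable q₁)
    (hq₂ : Measurable q₂) (h₀ : ∀ x, 0 ≤ q₀ x) (h₁ : ∀ x, 0 ≤ q₁ x) (h₂ : ∀ x, 0 ≤ q₂ x) :
    Measurable fun x => f (q₀ x) (q₁ x) (q₂ x) := by
  have h := hf.lowerSemicontinuous.measurable.comp (hq₀.prodMk (hq₁.prodMk hq₂))
  simpa only [Function.comp_def, max_eq_left (h₀ _), max_eq_left (h₁ _), max_eq_left (h₂ _)] using h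

theorem integrable_comp {μ : Measure X} (hf : IsRegularBound l₁ l₂ f) (hq₀ : Measurable q₀)
    (hq₁ : Measurable q₁) (hq₂ : Measurable q₂) (h₀ : ∀ x, 0 ≤ q₀ x) (h₁ : ∀ x, 0 ≤ q₁ x)
    (h₂ : ∀ x, 0 ≤ q₂ x) (hi : Integrable q₁ μ) :
    Integrable (fun x => f (q₀ x) (q₁ x) (q₂ x)) μ := by
  refine (hi.const_mul l₁).mono' (hf.measurable_comp hq₀ hq₁ hq₂ h₀ h₁ h₂).aestronglyMeasurable
    (Eventually.of_forall fun x => ?_)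
  rw [Real.norm_of_nonneg (hf.nonneg _ _ _ (h₀ x) (h₁ x) (h₂ x))]
  exact (hf.le_min _ _ _ (h₀ x) (h₁ x) (h₂ x)).trans (min_le_left _ _)

end IsRegularBound

/-- Approximating two suprema bounds a convex combination of them. -/
theorem convex_comb_csSup_le {S T : Set ℝ} {t C : ℝ} (hS : S.Nonempty) (hT : T.Nonempty)
    (ht : 0 ≤ t) (ht' : t ≤ 1) (h : ∀ a ∈ S, ∀ b ∈ T, t * a + (1 - t) * b ≤ C) :
    t * sSup S + (1 - t) * sSup T ≤ C := by
  refine le_of_forall_pos_le_add fun ε hε => ?_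
  obtain ⟨a, ha, ha'⟩ := exists_lt_of_lt_csSup hS (sub_lt_self (sSup S) hε)
  obtain ⟨b, hb, hb'⟩ := exists_lt_of_lt_csSup hT (sub_lt_self (sSup T) hε)
  nlinarith [h a ha b hb, mul_le_mul_of_nonneg_left ha'.le ht,
    mul_le_mul_of_nonneg_left hb'.le (sub_nonneg.2 ht')]

/-- Two densities weighted by nonnegative masses combine to a single weighted density. -/
theorem exists_weighted_density {X : Type*} [MeasurableSpace X] {μ : Measure X} {p q : X → ℝ}
    (hp : Measurable p) (hq : Measurable q) (hp0 : ∀ x, 0 ≤ p x) (hq0 : ∀ x, 0 ≤ q x)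
    (hp1 : ∫ x, p x ∂μ = 1) (hq1 : ∫ x, q x ∂μ = 1) {a b : ℝ} (ha : 0 ≤ a) (hb : 0 ≤ b) :
    ∃ r : X → ℝ, Measurable r ∧ (∀ x, 0 ≤ r x) ∧ (∫ x, r x ∂μ) = 1 ∧
      ∀ x, (a + b) * r x = a * p x + b * q x := by
  rcases (add_nonneg ha hb).eq_or_lt with h | h
  · have ha' : a = 0 := by linarith
    have hb' : b = 0 := by linarith
    exact ⟨p, hp, hp0, hp1, fun x => by simp [ha', hb']⟩
  · refine ⟨fun x => (a * p x + b * q x) / (a + b), by fun_prop, fun x => ?_, ?_, fun x => ?_⟩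
    · exact div_nonneg (add_nonneg (mul_nonneg ha (hp0 x)) (mul_nonneg hb (hq0 x))) h.le
    · have hpi : Integrable p μ := .of_integral_ne_zero (by simp [hp1])
      have hqi : Integrable q μ := .of_integral_ne_zero (by simp [hq1])
      rw [integral_div, integral_add (hpi.const_mul a) (hqi.const_mul b), integral_const_mul,
        integral_const_mul, hp1, hq1, mul_one, mul_one, div_self h.ne']
    · exact mul_div_cancel₀ _ h.ne'

section Continuation

variable {X : Type*} [MeasurableSpace X]

/-- The values of the continuation integral over all probability densities `p₀`. -/
def continuationValues (μ : Measure X) (p₁ p₂ : X → ℝ) (f : ℝ → ℝ → ℝ → ℝ) (z₀ z₁ z₂ : ℝ) :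
    Set ℝ :=
  {d : ℝ | ∃ p₀ : X → ℝ, Measurable p₀ ∧ (∀ x, 0 ≤ p₀ x) ∧ (∫ x, p₀ x ∂μ) = 1 ∧
    d = ∫ x, f (z₀ * p₀ x) (z₁ * p₁ x) (z₂ * p₂ x) ∂μ}

variable {μ : Measure X} {p₁ p₂ : X → ℝ} {l₁ l₂ : ℝ} {f g : ℝ → ℝ → ℝ → ℝ}

theorem continuationValues_nonempty (hp₁m : Measurable p₁) (hp₁0 : ∀ x, 0 ≤ p₁ x)
    (hp₁1 : ∫ x, p₁ x ∂μ = 1) (z₀ z₁ z₂ : ℝ) :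
    (continuationValues μ p₁ p₂ f z₀ z₁ z₂).Nonempty :=
  ⟨_, p₁, hp₁m, hp₁0, hp₁1, rfl⟩

namespace IsRegularBound

theorem integrable_continuation (hf : IsRegularBound l₁ l₂ f) {p₀ : X → ℝ} (hp₀m : Measurable p₀)
    (hp₁m : Measurable p₁) (hp₂m : Measurable p₂) (hp₀0 : ∀ x, 0 ≤ p₀ x) (hp₁0 : ∀ x, 0 ≤ p₁ x)
    (hp₂0 : ∀ x, 0 ≤ p₂ x) (hp₁1 : ∫ x, p₁ x ∂μ = 1) {z₀ z₁ z₂ : ℝ}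
    (h₀ : 0 ≤ z₀) (h₁ : 0 ≤ z₁) (h₂ : 0 ≤ z₂) :
    Integrable (fun x => f (z₀ * p₀ x) (z₁ * p₁ x) (z₂ * p₂ x)) μ :=
  have hpi : Integrable p₁ μ := .of_integral_ne_zero (by simp [hp₁1])
  hf.integrable_comp (hp₀m.const_mul z₀) (hp₁m.const_mul z₁) (hp₂m.const_mul z₂)
    (fun x => mul_nonneg h₀ (hp₀0 x)) (fun x => mul_nonneg h₁ (hp₁0 x))
    (fun x => mul_nonneg h₂ (hp₂0 x)) (hpi.const_mul z₁)

theorem bddAbove_continuationValues (hf : IsRegularBound l₁ l₂ f)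
    (hp₁m : Measurable p₁) (hp₂m : Measurable p₂) (hp₁0 : ∀ x, 0 ≤ p₁ x)
    (hp₂0 : ∀ x, 0 ≤ p₂ x) (hp₁1 : ∫ x, p₁ x ∂μ = 1) {z₀ z₁ z₂ : ℝ}
    (h₀ : 0 ≤ z₀) (h₁ : 0 ≤ z₁) (h₂ : 0 ≤ z₂) :
    BddAbove (continuationValues μ p₁ p₂ f z₀ z₁ z₂) := by
  refine ⟨∫ x, l₁ * (z₁ * p₁ x) ∂μ, ?_⟩
  rintro _ ⟨p₀, hp₀m, hp₀0, -, rfl⟩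
  have hpi : Integrable p₁ μ := .of_integral_ne_zero (by simp [hp₁1])
  refine integral_mono
    (hf.integrable_continuation hp₀m hp₁m hp₂m hp₀0 hp₁0 hp₂0 hp₁1 h₀ h₁ h₂)
    ((hpi.const_mul z₁).const_mul l₁) fun x => ?_
  exact (hf.le_min _ _ _ (mul_nonneg h₀ (hp₀0 x)) (mul_nonneg h₁ (hp₁0 x))
    (mul_nonneg h₂ (hp₂0 x))).trans (min_le_left _ _)

theorem sSup_continuationValues_le (hf : IsRegularBound l₁ l₂ f) (hg : IsRegularBound l₁ l₂ g)
    (hfg : ∀ z₀ z₁ z₂ : ℝ, 0 ≤ z₀ → 0 ≤ z₁ → 0 ≤ z₂ → f z₀ z₁ z₂ ≤ g z₀ z₁ z₂)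
    (hp₁m : Measurable p₁) (hp₂m : Measurable p₂) (hp₁0 : ∀ x, 0 ≤ p₁ x)
    (hp₂0 : ∀ x, 0 ≤ p₂ x) (hp₁1 : ∫ x, p₁ x ∂μ = 1) {z₀ z₁ z₂ w₀ w₁ w₂ : ℝ}
    (h₀ : 0 ≤ z₀) (h₁ : 0 ≤ z₁) (h₂ : 0 ≤ z₂) (hw₀ : z₀ ≤ w₀) (hw₁ : z₁ ≤ w₁) (hw₂ : z₂ ≤ w₂) :
    sSup (continuationValues μ p₁ p₂ f z₀ z₁ z₂) ≤
      sSup (continuationValues μ p₁ p₂ g w₀ w₁ w₂) := by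
  refine csSup_le (continuationValues_nonempty hp₁m hp₁0 hp₁1 _ _ _) ?_
  rintro _ ⟨p₀, hp₀m, hp₀0, hp₀1, rfl⟩
  have k₀ := h₀.trans hw₀
  have k₁ := h₁.trans hw₁
  have k₂ := h₂.trans hw₂
  refine le_csSup_of_le (hg.bddAbove_continuationValues hp₁m hp₂m hp₁0 hp₂0 hp₁1 k₀ k₁ k₂)
    ⟨p₀, hp₀m, hp₀0, hp₀1, rfl⟩ ?_
  refine integral_mono (hf.integrable_continuation hp₀m hp₁m hp₂m hp₀0 hp₁0 hp₂0 hp₁1 h₀ h₁ h₂)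
    (hg.integrable_continuation hp₀m hp₁m hp₂m hp₀0 hp₁0 hp₂0 hp₁1 k₀ k₁ k₂) fun x => ?_
  have n₀ := mul_nonneg h₀ (hp₀0 x)
  have n₁ := mul_nonneg h₁ (hp₁0 x)
  have n₂ := mul_nonneg h₂ (hp₂0 x)
  exact (hfg _ _ _ n₀ n₁ n₂).trans (hg.mono _ _ _ _ _ _ n₀ n₁ n₂
    (mul_le_mul_of_nonneg_right hw₀ (hp₀0 x)) (mul_le_mul_of_nonneg_right hw₁ (hp₁0 x))
    (mul_le_mul_of_nonneg_right hw₂ (hp₂0 x)))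

theorem sSup_continuationValues_concave (hf : IsRegularBound l₁ l₂ f)
    (hp₁m : Measurable p₁) (hp₂m : Measurable p₂) (hp₁0 : ∀ x, 0 ≤ p₁ x)
    (hp₂0 : ∀ x, 0 ≤ p₂ x) (hp₁1 : ∫ x, p₁ x ∂μ = 1) {z₀ z₁ z₂ w₀ w₁ w₂ t : ℝ}
    (h₀ : 0 ≤ z₀) (h₁ : 0 ≤ z₁) (h₂ : 0 ≤ z₂) (k₀ : 0 ≤ w₀) (k₁ : 0 ≤ w₁) (k₂ : 0 ≤ w₂)
    (ht : 0 ≤ t) (ht' : t ≤ 1) :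
    t * sSup (continuationValues μ p₁ p₂ f z₀ z₁ z₂) +
        (1 - t) * sSup (continuationValues μ p₁ p₂ f w₀ w₁ w₂) ≤
      sSup (continuationValues μ p₁ p₂ f (t * z₀ + (1 - t) * w₀) (t * z₁ + (1 - t) * w₁)
        (t * z₂ + (1 - t) * w₂)) := by
  refine convex_comb_csSup_le (continuationValues_nonempty hp₁m hp₁0 hp₁1 _ _ _)
    (continuationValues_nonempty hp₁m hp₁0 hp₁1 _ _ _) ht ht' ?_
  rintro _ ⟨p, hpm, hp0, hp1, rfl⟩ _ ⟨q, hqm, hq0, hq1, rfl⟩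
  have hs : 0 ≤ 1 - t := sub_nonneg.2 ht'
  obtain ⟨r, hrm, hr0, hr1, hr⟩ := exists_weighted_density hpm hqm hp0 hq0 hp1 hq1
    (mul_nonneg ht h₀) (mul_nonneg hs k₀)
  have m₀ := add_nonneg (mul_nonneg ht h₀) (mul_nonneg hs k₀)
  have m₁ := add_nonneg (mul_nonneg ht h₁) (mul_nonneg hs k₁)
  have m₂ := add_nonneg (mul_nonneg ht h₂) (mul_nonneg hs k₂)
  refine le_csSup_of_le (hf.bddAbove_continuationValues hp₁m hp₂m hp₁0 hp₂0 hp₁1 m₀ m₁ m₂)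
    ⟨r, hrm, hr0, hr1, rfl⟩ ?_
  have ip := (hf.integrable_continuation hpm hp₁m hp₂m hp0 hp₁0 hp₂0 hp₁1 h₀ h₁ h₂).const_mul t
  have iq := (hf.integrable_continuation hqm hp₁m hp₂m hq0 hp₁0 hp₂0 hp₁1 k₀ k₁ k₂).const_mul
    (1 - t)
  rw [← integral_const_mul, ← integral_const_mul, ← integral_add ip iq]
  refine integral_mono (ip.add iq)
    (hf.integrable_continuation hrm hp₁m hp₂m hr0 hp₁0 hp₂0 hp₁1 m₀ m₁ m₂) fun x => ?_
  refine (hf.concave _ _ _ _ _ _ t (mul_nonneg h₀ (hp0 x)) (mul_nonneg h₁ (hp₁0 x))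
    (mul_nonneg h₂ (hp₂0 x)) (mul_nonneg k₀ (hq0 x)) (mul_nonneg k₁ (hp₁0 x))
    (mul_nonneg k₂ (hp₂0 x)) ht ht').trans_eq ?_
  rw [hr x]
  congr 1 <;> ring

theorem of_recursion (hf : IsRegularBound l₁ l₂ f) (hl₁ : 0 ≤ l₁) (hl₂ : 0 ≤ l₂)
    (hp₁m : Measurable p₁) (hp₂m : Measurable p₂) (hp₁0 : ∀ x, 0 ≤ p₁ x)
    (hp₂0 : ∀ x, 0 ≤ p₂ x) (hp₁1 : ∫ x, p₁ x ∂μ = 1)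
    (hg : ∀ z₀ z₁ z₂ : ℝ, 0 ≤ z₀ → 0 ≤ z₁ → 0 ≤ z₂ → g z₀ z₁ z₂ =
      min (min (l₁ * z₁) (l₂ * z₂)) (z₀ + sSup (continuationValues μ p₁ p₂ f z₀ z₁ z₂))) :
    IsRegularBound l₁ l₂ g where
  nonneg z₀ z₁ z₂ h₀ h₁ h₂ := by
    rw [hg _ _ _ h₀ h₁ h₂]
    refine _root_.le_min (_root_.le_min (mul_nonneg hl₁ h₁) (mul_nonneg hl₂ h₂))
      (add_nonneg h₀ (Real.sSup_nonneg ?_))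
    rintro _ ⟨p₀, -, hp₀0, -, rfl⟩
    exact integral_nonneg fun x => hf.nonneg _ _ _ (mul_nonneg h₀ (hp₀0 x))
      (mul_nonneg h₁ (hp₁0 x)) (mul_nonneg h₂ (hp₂0 x))
  le_min z₀ z₁ z₂ h₀ h₁ h₂ := by
    rw [hg _ _ _ h₀ h₁ h₂]
    exact min_le_left _ _
  mono z₀ z₁ z₂ w₀ w₁ w₂ h₀ h₁ h₂ hw₀ hw₁ hw₂ := by
    rw [hg _ _ _ h₀ h₁ h₂, hg _ _ _ (h₀.trans hw₀) (h₁.trans hw₁) (h₂.trans hw₂)]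
    exact min_le_min ((isRegularBound_min hl₁ hl₂).mono _ _ _ _ _ _ h₀ h₁ h₂ hw₀ hw₁ hw₂)
      (add_le_add hw₀ (hf.sSup_continuationValues_le hf (fun _ _ _ _ _ _ => le_rfl)
        hp₁m hp₂m hp₁0 hp₂0 hp₁1 h₀ h₁ h₂ hw₀ hw₁ hw₂))
  concave z₀ z₁ z₂ w₀ w₁ w₂ t h₀ h₁ h₂ k₀ k₁ k₂ ht ht' := by
    have hs : 0 ≤ 1 - t := sub_nonneg.2 ht'
    rw [hg _ _ _ h₀ h₁ h₂, hg _ _ _ k₀ k₁ k₂,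
      hg _ _ _ (add_nonneg (mul_nonneg ht h₀) (mul_nonneg hs k₀))
        (add_nonneg (mul_nonneg ht h₁) (mul_nonneg hs k₁))
        (add_nonneg (mul_nonneg ht h₂) (mul_nonneg hs k₂))]
    refine _root_.le_min ?_ ?_
    · exact (add_le_add (mul_le_mul_of_nonneg_left (min_le_left _ _) ht)
        (mul_le_mul_of_nonneg_left (min_le_left _ _) hs)).trans
        ((isRegularBound_min hl₁ hl₂).concave _ _ _ _ _ _ t h₀ h₁ h₂ k₀ k₁ k₂ ht ht')
    · have h := hf.sSup_continuationValues_concave hp₁m hp₂m hp₁0 hp₂0 hp₁1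
        h₀ h₁ h₂ k₀ k₁ k₂ ht ht'
      refine (add_le_add (mul_le_mul_of_nonneg_left (min_le_right _ _) ht)
        (mul_le_mul_of_nonneg_left (min_le_right _ _) hs)).trans ?_
      linarith

/-- Regular bounds are closed under pointwise limits on the orthant. -/
theorem of_tendsto {F : ℕ → ℝ → ℝ → ℝ → ℝ} (hF : ∀ n, IsRegularBound l₁ l₂ (F n))
    (hlim : ∀ z₀ z₁ z₂ : ℝ, 0 ≤ z₀ → 0 ≤ z₁ → 0 ≤ z₂ →
      Tendsto (fun n => F n z₀ z₁ z₂) atTop (nhds (f z₀ z₁ z₂))) :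
    IsRegularBound l₁ l₂ f where
  nonneg _ _ _ h₀ h₁ h₂ :=
    ge_of_tendsto' (hlim _ _ _ h₀ h₁ h₂) fun n => (hF n).nonneg _ _ _ h₀ h₁ h₂
  le_min _ _ _ h₀ h₁ h₂ :=
    le_of_tendsto' (hlim _ _ _ h₀ h₁ h₂) fun n => (hF n).le_min _ _ _ h₀ h₁ h₂
  mono _ _ _ _ _ _ h₀ h₁ h₂ hw₀ hw₁ hw₂ :=
    le_of_tendsto_of_tendsto' (hlim _ _ _ h₀ h₁ h₂)
      (hlim _ _ _ (h₀.trans hw₀) (h₁.trans hw₁) (h₂.trans hw₂))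
      fun n => (hF n).mono _ _ _ _ _ _ h₀ h₁ h₂ hw₀ hw₁ hw₂
  concave _ _ _ _ _ _ t h₀ h₁ h₂ k₀ k₁ k₂ ht ht' :=
    have hs : 0 ≤ 1 - t := sub_nonneg.2 ht'
    le_of_tendsto_of_tendsto'
      (((hlim _ _ _ h₀ h₁ h₂).const_mul t).add ((hlim _ _ _ k₀ k₁ k₂).const_mul (1 - t)))
      (hlim _ _ _ (add_nonneg (mul_nonneg ht h₀) (mul_nonneg hs k₀))
        (add_nonneg (mul_nonneg ht h₁) (mul_nonneg hs k₁))
        (add_nonneg (mul_nonneg ht h₂) (mul_nonneg hs k₂)))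
      fun n => (hF n).concave _ _ _ _ _ _ t h₀ h₁ h₂ k₀ k₁ k₂ ht ht'

end IsRegularBound

end Continuation

/-- The sequence `(ρₙ)ₙ` is pointwise nonincreasing in `n`, i.e.
`ρ_{n+1}(z) ≤ ρₙ(z)` for all `n ≥ 0` and `z ∈ [0,∞)³`; consequently the pointwise limit
`ρ(z) := limₙ ρₙ(z)` exists for every `z`, and `ρ` is nonnegative, nondecreasing in each
coordinate, concave on `[0,∞)³`, and satisfies `ρ(z) ≤ min(λ₁ z₁, λ₂ z₂)` for all `z`. -/
theorem rho_antitone_limit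
    {X : Type*} [MeasurableSpace X] (μ : Measure X) [SigmaFinite μ]
    (p₁ p₂ : X → ℝ) (hp₁m : Measurable p₁) (hp₂m : Measurable p₂)
    (hp₁0 : ∀ x, 0 ≤ p₁ x) (hp₂0 : ∀ x, 0 ≤ p₂ x)
    (hp₁1 : ∫ x, p₁ x ∂μ = 1) (hp₂1 : ∫ x, p₂ x ∂μ = 1)
    (l₁ l₂ : ℝ) (hl₁ : 0 < l₁) (hl₂ : 0 < l₂)
    (ρ : ℕ → ℝ → ℝ → ℝ → ℝ)
    (hρ0 : ∀ z₀ z₁ z₂ : ℝ, ρ 0 z₀ z₁ z₂ = min (l₁ * z₁) (l₂ * z₂))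
    (hρrec : ∀ (n : ℕ) (z₀ z₁ z₂ : ℝ), 0 ≤ z₀ → 0 ≤ z₁ → 0 ≤ z₂ →
      ρ (n + 1) z₀ z₁ z₂ =
        min (min (l₁ * z₁) (l₂ * z₂))
          (z₀ + sSup {d : ℝ | ∃ p₀ : X → ℝ, Measurable p₀ ∧ (∀ x, 0 ≤ p₀ x) ∧
            (∫ x, p₀ x ∂μ) = 1 ∧
            d = ∫ x, ρ n (z₀ * p₀ x) (z₁ * p₁ x) (z₂ * p₂ x) ∂μ})) :
    (∀ (n : ℕ) (z₀ z₁ z₂ : ℝ), 0 ≤ z₀ → 0 ≤ z₁ → 0 ≤ z₂ →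
        ρ (n + 1) z₀ z₁ z₂ ≤ ρ n z₀ z₁ z₂) ∧
    ∃ ρlim : ℝ → ℝ → ℝ → ℝ,
      (∀ (z₀ z₁ z₂ : ℝ), 0 ≤ z₀ → 0 ≤ z₁ → 0 ≤ z₂ →
        Tendsto (fun n : ℕ => ρ n z₀ z₁ z₂) atTop (nhds (ρlim z₀ z₁ z₂))) ∧
      (∀ (z₀ z₁ z₂ : ℝ), 0 ≤ z₀ → 0 ≤ z₁ → 0 ≤ z₂ → 0 ≤ ρlim z₀ z₁ z₂) ∧
      (∀ (z₀ z₁ z₂ w₀ w₁ w₂ : ℝ), 0 ≤ z₀ → 0 ≤ z₁ → 0 ≤ z₂ →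
        z₀ ≤ w₀ → z₁ ≤ w₁ → z₂ ≤ w₂ → ρlim z₀ z₁ z₂ ≤ ρlim w₀ w₁ w₂) ∧
      (∀ (z₀ z₁ z₂ w₀ w₁ w₂ t : ℝ), 0 ≤ z₀ → 0 ≤ z₁ → 0 ≤ z₂ →
        0 ≤ w₀ → 0 ≤ w₁ → 0 ≤ w₂ → 0 ≤ t → t ≤ 1 →
        t * ρlim z₀ z₁ z₂ + (1 - t) * ρlim w₀ w₁ w₂ ≤
          ρlim (t * z₀ + (1 - t) * w₀) (t * z₁ + (1 - t) * w₁) (t * z₂ + (1 - t) * w₂)) ∧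
      (∀ (z₀ z₁ z₂ : ℝ), 0 ≤ z₀ → 0 ≤ z₁ → 0 ≤ z₂ →
        ρlim z₀ z₁ z₂ ≤ min (l₁ * z₁) (l₂ * z₂)) := by
  have hreg : ∀ n, IsRegularBound l₁ l₂ (ρ n) := by
    intro n
    induction n with
    | zero =>
      rw [show ρ 0 = fun _ z₁ z₂ => min (l₁ * z₁) (l₂ * z₂) from
        funext fun z₀ => funext fun z₁ => funext fun z₂ => hρ0 z₀ z₁ z₂]
      exact isRegularBound_min hl₁.le hl₂.le
    | succ n ih => exact ih.of_recursion hl₁.le hl₂.le hp₁m hp₂m hp₁0 hp₂0 hp₁1 (hρrec n)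
  have hanti : ∀ (n : ℕ) (z₀ z₁ z₂ : ℝ), 0 ≤ z₀ → 0 ≤ z₁ → 0 ≤ z₂ →
      ρ (n + 1) z₀ z₁ z₂ ≤ ρ n z₀ z₁ z₂ := by
    intro n
    induction n with
    | zero =>
      intro z₀ z₁ z₂ h₀ h₁ h₂
      rw [hρ0]
      exact (hreg 1).le_min _ _ _ h₀ h₁ h₂
    | succ n ih =>
      intro z₀ z₁ z₂ h₀ h₁ h₂
      rw [hρrec (n + 1) _ _ _ h₀ h₁ h₂, hρrec n _ _ _ h₀ h₁ h₂]
      exact min_le_min le_rfl (add_le_add le_rfl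
        ((hreg (n + 1)).sSup_continuationValues_le (hreg n) ih hp₁m hp₂m hp₁0 hp₂0 hp₁1
          h₀ h₁ h₂ le_rfl le_rfl le_rfl))
  have hlim : ∀ z₀ z₁ z₂ : ℝ, 0 ≤ z₀ → 0 ≤ z₁ → 0 ≤ z₂ →
      Tendsto (fun n => ρ n z₀ z₁ z₂) atTop (nhds (⨅ n, ρ n z₀ z₁ z₂)) := by
    intro z₀ z₁ z₂ h₀ h₁ h₂
    refine tendsto_atTop_ciInf (antitone_nat_of_succ_le fun n => hanti n _ _ _ h₀ h₁ h₂) ⟨0, ?_⟩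
    rintro _ ⟨n, rfl⟩
    exact (hreg n).nonneg _ _ _ h₀ h₁ h₂
  have hl := IsRegularBound.of_tendsto (f := fun z₀ z₁ z₂ => ⨅ n, ρ n z₀ z₁ z₂) hreg hlim
  exact ⟨hanti, _, hlim, hl.nonneg, hl.mono, hl.concave, hl.le_min⟩
end

section
/- Necessary optimality condition (Theorem 1): Suppose the pair (π*, ℚ₀), where π* is a testing policy and ℚ₀ is a probability measure on X^ℕ, is minimax optimal, i.e. (i) J(π*, ℚ₀) = sup_ℙ J(π*, ℙ), the supremum being over all probability measures ℙ on X^ℕ, and (ii) sup_ℙ J(π*, ℙ) ≤ sup_ℙ J(π, ℙ) for every testing policy π. Then there exists a constant c ≤ min(λ₁, λ₂) such that e_{π*}(x) ≤ c for every x ∈ X^ℕ and e_{π*}(x) = c for ℚ₀-almost every x. -/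
open MeasureTheory ENNReal

/-- A testing policy: sequences of randomized stopping rules `ψₙ : Xⁿ → [0,1]` and
randomized decision rules `δₙ : Xⁿ → [0,1]`, all measurable. -/
structure Policy (X : Type*) [MeasurableSpace X] where
  ψ : (n : ℕ) → (Fin n → X) → ℝ
  δ : (n : ℕ) → (Fin n → X) → ℝ
  ψ_meas : ∀ n, Measurable (ψ n)
  δ_meas : ∀ n, Measurable (δ n)
  ψ_mem : ∀ n y, ψ n y ∈ Set.Icc (0 : ℝ) 1
  δ_mem : ∀ n y, δ n y ∈ Set.Icc (0 : ℝ) 1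

variable {X : Type*} [MeasurableSpace X]

/-- `∏_{k=0}^{n-1} (1 − ψ_k(x₁,…,x_k))`: the probability of not having stopped before
time `n`, given the trajectory `x`. -/
noncomputable def contProb (π : Policy X) (x : ℕ → X) (n : ℕ) : ℝ :=
  ∏ k ∈ Finset.range n, (1 - π.ψ k fun i : Fin k => x i)

/-- The stopping mass at time `n`: `sₙ(x) = ψₙ(x₁,…,xₙ) · ∏_{k<n} (1 − ψ_k(x₁,…,x_k))`. -/
noncomputable def stopMass (π : Policy X) (x : ℕ → X) (n : ℕ) : ℝ :=
  π.ψ n (fun i : Fin n => x i) * contProb π x n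

/-- The expected sample size given the trajectory `x` (expectation over the independent
Bernoulli randomization of the stopping rules):
`e_π(x) = Σ_{n=0}^∞ ∏_{k=0}^{n} (1 − ψ_k(x₁,…,x_k)) ∈ [0,∞]`. -/
noncomputable def ess (π : Policy X) (x : ℕ → X) : ℝ≥0∞ :=
  ∑' n : ℕ, ENNReal.ofReal (contProb π x (n + 1))

/-- Expected sample size `γ(π,ℙ) = ∫ e_π dℙ` under a measure `ℙ` on `X^ℕ`. -/
noncomputable def gammaESS (π : Policy X) (P : Measure (ℕ → X)) : ℝ≥0∞ :=
  ∫⁻ x, ess π x ∂P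

/-- First error probability `α₁(π) = ∫ Σ_{n≥0} (1 − δₙ(x₁,…,xₙ)) sₙ(x) dℙ₁(x)`. -/
noncomputable def alpha1 (π : Policy X) (P1seq : Measure (ℕ → X)) : ℝ≥0∞ :=
  ∫⁻ x, ∑' n : ℕ,
    ENNReal.ofReal ((1 - π.δ n fun i : Fin n => x i) * stopMass π x n) ∂P1seq

/-- Second error probability `α₂(π) = ∫ Σ_{n≥0} δₙ(x₁,…,xₙ) sₙ(x) dℙ₂(x)`. -/
noncomputable def alpha2 (π : Policy X) (P2seq : Measure (ℕ → X)) : ℝ≥0∞ :=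
  ∫⁻ x, ∑' n : ℕ,
    ENNReal.ofReal ((π.δ n fun i : Fin n => x i) * stopMass π x n) ∂P2seq

/-- The objective `J(π, ℙ) = γ(π, ℙ) + λ₁ α₁(π) + λ₂ α₂(π)`. -/
noncomputable def objJ (l₁ l₂ : ℝ) (π : Policy X)
    (P1seq P2seq P : Measure (ℕ → X)) : ℝ≥0∞ :=
  gammaESS π P + ENNReal.ofReal l₁ * alpha1 π P1seq + ENNReal.ofReal l₂ * alpha2 π P2seq

/-- The policy which stops before taking any sample and always takes the decision `d`. -/
def stopAtOnce (X : Type*) [MeasurableSpace X] (d : ℝ) (hd : d ∈ Set.Icc (0 : ℝ) 1) :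
    Policy X where
  ψ _ _ := 1
  δ _ _ := d
  ψ_meas _ := measurable_const
  δ_meas _ := measurable_const
  ψ_mem _ _ := ⟨zero_le_one, le_rfl⟩
  δ_mem _ _ := hd

lemma contProb_stopAtOnce (d : ℝ) (hd : d ∈ Set.Icc (0 : ℝ) 1) (x : ℕ → X) (n : ℕ) :
    contProb (stopAtOnce X d hd) x n = 0 ^ n := by
  simp [contProb, stopAtOnce]

lemma stopMass_stopAtOnce (d : ℝ) (hd : d ∈ Set.Icc (0 : ℝ) 1) (x : ℕ → X) (n : ℕ) :
    stopMass (stopAtOnce X d hd) x n = 0 ^ n := by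
  rw [stopMass, contProb_stopAtOnce]
  simp [stopAtOnce]

lemma tsum_ofReal_mul_zero_pow (a : ℝ) :
    ∑' n : ℕ, ENNReal.ofReal (a * 0 ^ n) = ENNReal.ofReal a := by
  rw [tsum_eq_single 0 fun n hn => by simp [hn]]
  simp

lemma objJ_stopAtOnce (l₁ l₂ d : ℝ) (hd : d ∈ Set.Icc (0 : ℝ) 1)
    (P1seq P2seq P : Measure (ℕ → X)) [IsProbabilityMeasure P1seq]
    [IsProbabilityMeasure P2seq] :
    objJ l₁ l₂ (stopAtOnce X d hd) P1seq P2seq P =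
      ENNReal.ofReal l₁ * ENNReal.ofReal (1 - d) + ENNReal.ofReal l₂ * ENNReal.ofReal d := by
  have h₁ : alpha1 (stopAtOnce X d hd) P1seq = ENNReal.ofReal (1 - d) := by
    simp only [alpha1, stopMass_stopAtOnce]
    simp only [stopAtOnce, tsum_ofReal_mul_zero_pow]
    simp
  have h₂ : alpha2 (stopAtOnce X d hd) P2seq = ENNReal.ofReal d := by
    simp only [alpha2, stopMass_stopAtOnce]
    simp only [stopAtOnce, tsum_ofReal_mul_zero_pow]
    simp
  have h₀ : gammaESS (stopAtOnce X d hd) P = 0 := by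
    simp [gammaESS, ess, contProb_stopAtOnce]
  rw [objJ, h₀, h₁, h₂, zero_add]

lemma measurable_contProb (π : Policy X) (n : ℕ) : Measurable fun x => contProb π x n := by
  unfold contProb
  refine Finset.measurable_fun_prod _ fun k _ => measurable_const.sub ?_
  exact (π.ψ_meas k).comp (measurable_pi_lambda _ fun i => measurable_pi_apply _)

lemma measurable_ess (π : Policy X) : Measurable (ess π) := by
  unfold ess
  exact Measurable.tsum fun n => (measurable_contProb π (n + 1)).ennreal_ofReal

/-- A measurable function which is bounded by a finite constant `c` and whose integral against a
probability measure is at least `c` is almost everywhere equal to `c`. -/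
lemma ae_eq_const_of_le_lintegral {Ω : Type*} [MeasurableSpace Ω] (P : Measure Ω)
    [IsProbabilityMeasure P] {f : Ω → ℝ≥0∞} {c : ℝ≥0∞} (hc : c ≠ ∞)
    (hle : ∀ x, f x ≤ c) (hint : c ≤ ∫⁻ x, f x ∂P) : ∀ᵐ x ∂P, f x = c := by
  have hfin : ∫⁻ x, f x ∂P ≠ ∞ :=
    ne_top_of_le_ne_top hc ((lintegral_mono hle).trans (by simp))
  exact ae_eq_of_ae_le_of_lintegral_le (ae_of_all _ hle) hfin aemeasurable_const
    (by simpa using hint)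

/-- necessary optimality condition, Theorem 1: if `(π*, ℚ₀)` is minimax
optimal, then there is a constant `c ≤ min(λ₁, λ₂)` such that `e_{π*}(x) ≤ c` for every
trajectory `x` and `e_{π*}(x) = c` for `ℚ₀`-almost every `x`. Here `ℙ₁` and `ℙ₂` are the
countable i.i.d. products `P₁^ℕ` and `P₂^ℕ`, characterized by their values on cylinder
sets. -/
theorem necessary_optimality
    [Nonempty X]
    (P₁ P₂ : Measure X) [IsProbabilityMeasure P₁] [IsProbabilityMeasure P₂]
    (l₁ l₂ : ℝ) (hl₁ : 0 < l₁) (hl₂ : 0 < l₂)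
    (ℙ₁ ℙ₂ : Measure (ℕ → X)) [IsProbabilityMeasure ℙ₁] [IsProbabilityMeasure ℙ₂]
    (hℙ₁ : ∀ (n : ℕ) (s : Fin n → Set X), (∀ i, MeasurableSet (s i)) →
      ℙ₁ {x : ℕ → X | ∀ i : Fin n, x i ∈ s i} = ∏ i, P₁ (s i))
    (hℙ₂ : ∀ (n : ℕ) (s : Fin n → Set X), (∀ i, MeasurableSet (s i)) →
      ℙ₂ {x : ℕ → X | ∀ i : Fin n, x i ∈ s i} = ∏ i, P₂ (s i))
    (πs : Policy X) (Q₀ : Measure (ℕ → X)) [IsProbabilityMeasure Q₀]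
    (hopt₁ : objJ l₁ l₂ πs ℙ₁ ℙ₂ Q₀ =
      ⨆ (P : Measure (ℕ → X)) (_ : IsProbabilityMeasure P), objJ l₁ l₂ πs ℙ₁ ℙ₂ P)
    (hopt₂ : ∀ π : Policy X,
      (⨆ (P : Measure (ℕ → X)) (_ : IsProbabilityMeasure P), objJ l₁ l₂ πs ℙ₁ ℙ₂ P) ≤
      ⨆ (P : Measure (ℕ → X)) (_ : IsProbabilityMeasure P), objJ l₁ l₂ π ℙ₁ ℙ₂ P) :
    ∃ c : ℝ≥0∞, c ≤ min (ENNReal.ofReal l₁) (ENNReal.ofReal l₂) ∧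
      (∀ x : ℕ → X, ess πs x ≤ c) ∧ (∀ᵐ x ∂Q₀, ess πs x = c) := by
  set A : ℝ≥0∞ := ENNReal.ofReal l₁ * alpha1 πs ℙ₁
  set B : ℝ≥0∞ := ENNReal.ofReal l₂ * alpha2 πs ℙ₂
  set V : ℝ≥0∞ := ⨆ (P : Measure (ℕ → X)) (_ : IsProbabilityMeasure P), objJ l₁ l₂ πs ℙ₁ ℙ₂ P
  have hV₁ : V ≤ ENNReal.ofReal l₁ := by
    refine (hopt₂ (stopAtOnce X 0 (by simp))).trans (iSup₂_le fun P _ => ?_)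
    simp [objJ_stopAtOnce]
  have hV₂ : V ≤ ENNReal.ofReal l₂ := by
    refine (hopt₂ (stopAtOnce X 1 (by simp))).trans (iSup₂_le fun P _ => ?_)
    simp [objJ_stopAtOnce]
  have hVtop : V ≠ ∞ := ne_top_of_le_ne_top ENNReal.ofReal_ne_top hV₁
  have hpoint : ∀ x, ess πs x + A + B ≤ V := fun x => by
    have h : objJ l₁ l₂ πs ℙ₁ ℙ₂ (Measure.dirac x) ≤ V :=
      le_iSup₂ (f := fun (P : Measure (ℕ → X)) (_ : IsProbabilityMeasure P) =>
        objJ l₁ l₂ πs ℙ₁ ℙ₂ P) (Measure.dirac x) inferInstance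
    rwa [objJ, gammaESS, lintegral_dirac' x (measurable_ess πs)] at h
  have hsup : (⨆ x, ess πs x) + (A + B) ≤ V := by
    rw [ENNReal.iSup_add]
    exact iSup_le fun x => (add_assoc _ _ _).symm.le.trans (hpoint x)
  have hle : (⨆ x, ess πs x) ≤ V := le_self_add.trans hsup
  have hAB : A + B ≠ ∞ := ne_top_of_le_ne_top hVtop (le_add_self.trans hsup)
  refine ⟨⨆ x, ess πs x, hle.trans (le_min hV₁ hV₂), le_iSup _, ?_⟩
  refine ae_eq_const_of_le_lintegral Q₀ (ne_top_of_le_ne_top hVtop hle) (le_iSup _) ?_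
  rw [← hopt₁, objJ, add_assoc] at hsup
  exact (ENNReal.add_le_add_iff_right hAB).1 hsup
end

section
/- For every n ≥ 0, every z₁, z₂ ≥ 0 and every z₀ ≥ 0, the right derivative of the function t ↦ ρₙ(t, z₁, z₂) at t = z₀ exists and equals a nonnegative integer at most n; i.e. there exists k ∈ {0, 1, …, n} such that lim_{h→0⁺} (ρₙ(z₀ + h, z₁, z₂) − ρₙ(z₀, z₁, z₂))/h = k. -/
open Filter

/-- A simultaneous optimal allocation: if the caps `b x j` decrease in `j`, then a mass `t` can be
distributed among the points of `X` so that, for each `j < n`, the total mass counted up to the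
caps `b · j` is as large as possible. -/
lemma exists_allocation {X : Type*} [Fintype X] [Nonempty X] (b : X → ℕ → ℝ)
    (hb : ∀ x, Antitone (b x)) (t : ℝ) (n : ℕ) (c : X → ℝ) (hc : ∀ x, ∀ j < n, c x ≤ b x j)
    (hct : ∑ x, c x ≤ t) :
    ∃ a : X → ℝ, (∀ x, c x ≤ a x) ∧ ∑ x, a x = t ∧
      ∀ j < n, ∑ x, min (a x) (b x j) = min t (∑ x, b x j) := by
  induction n generalizing c with
  | zero =>
    have hX : (0 : ℝ) < Fintype.card X := by exact_mod_cast Fintype.card_pos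
    refine ⟨fun x => c x + (t - ∑ x, c x) / Fintype.card X, fun x => ?_, ?_, by simp⟩
    · have : 0 ≤ (t - ∑ x, c x) / Fintype.card X := div_nonneg (by linarith) hX.le
      linarith
    · rw [Finset.sum_add_distrib, Finset.sum_const, Finset.card_univ, nsmul_eq_mul]
      field_simp
      ring
  | succ n ih =>
    rcases le_or_gt (∑ x, b x n) t with h | h
    · obtain ⟨a, ha, hat, haj⟩ := ih (fun x => b x n) (fun x j hj => hb x hj.le) h
      refine ⟨a, fun x => (hc x n n.lt_succ_self).trans (ha x), hat, fun j hj => ?_⟩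
      rcases Nat.lt_succ_iff_lt_or_eq.1 hj with hj | rfl
      · exact haj j hj
      · rw [min_eq_right h]
        exact Finset.sum_congr rfl fun x _ => min_eq_right (ha x)
    · have hd : 0 < ∑ x, b x n - ∑ x, c x := by linarith
      set θ := (t - ∑ x, c x) / (∑ x, b x n - ∑ x, c x) with hθ
      have hθ0 : 0 ≤ θ := div_nonneg (by linarith) hd.le
      have hθ1 : θ ≤ 1 := (div_le_one hd).2 (by linarith)
      have hθt : θ * (∑ x, b x n - ∑ x, c x) = t - ∑ x, c x := div_mul_cancel₀ _ hd.ne'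
      have hcb : ∀ x, c x ≤ b x n := fun x => hc x n n.lt_succ_self
      have hsum : ∑ x, (c x + θ * (b x n - c x)) = t := by
        rw [Finset.sum_add_distrib, ← Finset.mul_sum, Finset.sum_sub_distrib, hθt]
        ring
      refine ⟨fun x => c x + θ * (b x n - c x), fun x => ?_, hsum, fun j hj => ?_⟩
      · have := mul_nonneg hθ0 (sub_nonneg.2 (hcb x))
        simpa using this
      · have hj' : j ≤ n := Nat.lt_succ_iff.1 hj
        have hle : ∀ x, c x + θ * (b x n - c x) ≤ b x j := fun x => by
          have h1 := mul_le_mul_of_nonneg_right hθ1 (sub_nonneg.2 (hcb x))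
          have h2 := hb x hj'
          linarith
        have htj : t ≤ ∑ x, b x j := by
          rw [← hsum]
          exact Finset.sum_le_sum fun x _ => hle x
        rw [min_eq_left htj, ← hsum]
        exact Finset.sum_congr rfl fun x _ => min_eq_left (hle x)

/-- The sup-convolution of functions `c x + ∑ j, min · (b x j)` with antitone breakpoints adds the
constants and the breakpoints. -/
lemma isGreatest_sum_allocation {X : Type*} [Fintype X] [Nonempty X] (f : X → ℝ → ℝ) (n : ℕ)
    (c : X → ℝ) (b : X → ℕ → ℝ) (hb : ∀ x, Antitone (b x)) (hb0 : ∀ x j, 0 ≤ b x j)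
    (hf : ∀ x, ∀ t, 0 ≤ t → f x t = c x + ∑ j ∈ Finset.range n, min t (b x j))
    (t : ℝ) (ht : 0 ≤ t) :
    IsGreatest {d : ℝ | ∃ p : X → ℝ, (∀ x, 0 ≤ p x) ∧ (∑ x, p x) = 1 ∧ d = ∑ x, f x (t * p x)}
      (∑ x, c x + ∑ j ∈ Finset.range n, min t (∑ x, b x j)) := by
  have key : ∀ a : X → ℝ, (∀ x, 0 ≤ a x) → ∑ x, f x (a x) =
      ∑ x, c x + ∑ j ∈ Finset.range n, ∑ x, min (a x) (b x j) := fun a ha => by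
    rw [Finset.sum_comm, ← Finset.sum_add_distrib]
    exact Finset.sum_congr rfl fun x _ => hf x _ (ha x)
  constructor
  · obtain ⟨a, ha, hat, haj⟩ := exists_allocation b hb t n (fun _ => 0)
      (fun x j _ => hb0 x j) (by simpa using ht)
    obtain ⟨p, hp0, hp1, hpa⟩ : ∃ p : X → ℝ, (∀ x, 0 ≤ p x) ∧ ∑ x, p x = 1 ∧
        ∀ x, t * p x = a x := by
      rcases ht.eq_or_lt with rfl | ht'
      · refine ⟨fun _ => (Fintype.card X : ℝ)⁻¹, fun _ => by positivity, by simp, fun x => ?_⟩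
        rw [zero_mul]
        exact ((Finset.sum_eq_zero_iff_of_nonneg fun x _ => ha x).1 hat x (Finset.mem_univ x)).symm
      · refine ⟨fun x => a x / t, fun x => div_nonneg (ha x) ht, ?_, fun x => ?_⟩
        · rw [← Finset.sum_div, hat, div_self ht'.ne']
        · field_simp
    refine ⟨p, hp0, hp1, ?_⟩
    simp_rw [hpa]
    rw [key a ha]
    congr 1
    exact Finset.sum_congr rfl fun j hj => (haj j (Finset.mem_range.1 hj)).symm
  · rintro d ⟨p, hp0, hp1, rfl⟩
    rw [key _ fun x => mul_nonneg ht (hp0 x)]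
    gcongr with j
    refine le_min ?_ (Finset.sum_le_sum fun x _ => min_le_right _ _)
    calc ∑ x, min (t * p x) (b x j) ≤ ∑ x, t * p x := Finset.sum_le_sum fun x _ => min_le_left _ _
      _ = t := by rw [← Finset.mul_sum, hp1, mul_one]

/-- Adding the identity to `C + ∑ j, min · (B j)` and truncating at a constant again gives a
function of this form, with one more breakpoint. -/
lemma exists_breakpoints_min_add (g C : ℝ) (n : ℕ) (B : ℕ → ℝ) (hB : Antitone B)
    (hB0 : ∀ j, 0 ≤ B j) :
    ∃ (c : ℝ) (b : ℕ → ℝ), Antitone b ∧ (∀ j, 0 ≤ b j) ∧ ∀ t, 0 ≤ t →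
      min g (t + (C + ∑ j ∈ Finset.range n, min t (B j))) =
        c + ∑ j ∈ Finset.range (n + 1), min t (b j) := by
  set F : ℝ → ℝ := fun t => t + (C + ∑ j ∈ Finset.range n, min t (B j)) with hF
  have hmono : Monotone F := fun s t hst => by
    simp only [hF]
    gcongr
  rcases le_or_gt g C with hg | hg
  · refine ⟨g, fun _ => 0, antitone_const, fun _ => le_rfl, fun t ht => ?_⟩
    have : 0 ≤ ∑ j ∈ Finset.range n, min t (B j) :=
      Finset.sum_nonneg fun j _ => le_min ht (hB0 j)
    rw [min_eq_left (by linarith)]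
    simp [min_eq_right ht]
  · have hF0 : F 0 = C := by simp [hF, hB0]
    have hFg : g ≤ F (g - C) := by
      have : 0 ≤ ∑ j ∈ Finset.range n, min (g - C) (B j) :=
        Finset.sum_nonneg fun j _ => le_min (by linarith) (hB0 j)
      simp only [hF]
      linarith
    have hcont : Continuous F := by fun_prop
    obtain ⟨τ, ⟨hτ0, -⟩, hτ⟩ := intermediate_value_Icc (sub_pos.2 hg).le hcont.continuousOn
      ⟨hF0.trans_le hg.le, hFg⟩
    refine ⟨C, fun j => Nat.casesOn j τ fun i => min τ (B i), ?_, ?_, fun t ht => ?_⟩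
    · refine antitone_nat_of_succ_le fun j => ?_
      cases j with
      | zero => exact min_le_left _ _
      | succ j => exact min_le_min_left _ (hB j.le_succ)
    · intro j
      cases j with
      | zero => exact hτ0
      | succ j => exact le_min hτ0 (hB0 j)
    · change min g (F t) = _
      rw [← hτ, ← hmono.map_min, Finset.sum_range_succ']
      simp only [hF, min_comm τ t, min_assoc]
      rw [add_left_comm, add_comm (min t τ)]
      rfl

/-- The right difference quotients of `min · b` converge to `1` before `b` and to `0` after. -/
lemma tendsto_slope_min (z b : ℝ) :
    Tendsto (fun h : ℝ => (min (z + h) b - min z b) / h) (nhdsWithin 0 (Set.Ioi 0))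
      (nhds (if z < b then 1 else 0)) := by
  refine tendsto_const_nhds.congr' ?_
  split_ifs with hz
  · filter_upwards [Ioo_mem_nhdsGT (sub_pos.2 hz)] with h hh
    have := hh.1
    have := hh.2
    rw [min_eq_left (by linarith), min_eq_left hz.le, add_sub_cancel_left, div_self hh.1.ne']
  · filter_upwards [self_mem_nhdsWithin] with h hh
    have : 0 < h := hh
    rw [min_eq_right (by linarith), min_eq_right (not_lt.1 hz), sub_self, zero_div]

/-- For every `n ≥ 0`, every `z₁, z₂ ≥ 0` and every `z₀ ≥ 0`, the right
derivative of the function `t ↦ ρₙ(t, z₁, z₂)` at `t = z₀` exists and equals a nonnegative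
integer at most `n`; i.e. there exists `k ∈ {0, 1, …, n}` such that
`lim_{h→0⁺} (ρₙ(z₀ + h, z₁, z₂) − ρₙ(z₀, z₁, z₂))/h = k`.
Here `X` is a nonempty finite set and the supremum in the recursion runs over probability
mass functions on `X`. -/
theorem rho_right_deriv_nat
    {X : Type*} [Fintype X] [Nonempty X]
    (p₁ p₂ : X → ℝ) (hp₁0 : ∀ x, 0 ≤ p₁ x) (hp₂0 : ∀ x, 0 ≤ p₂ x)
    (hp₁1 : ∑ x, p₁ x = 1) (hp₂1 : ∑ x, p₂ x = 1)
    (l₁ l₂ : ℝ) (hl₁ : 0 < l₁) (hl₂ : 0 < l₂)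
    (ρ : ℕ → ℝ → ℝ → ℝ → ℝ)
    (hρ0 : ∀ z₀ z₁ z₂ : ℝ, ρ 0 z₀ z₁ z₂ = min (l₁ * z₁) (l₂ * z₂))
    (hρrec : ∀ (n : ℕ) (z₀ z₁ z₂ : ℝ), 0 ≤ z₀ → 0 ≤ z₁ → 0 ≤ z₂ →
      ρ (n + 1) z₀ z₁ z₂ =
        min (min (l₁ * z₁) (l₂ * z₂))
          (z₀ + sSup {d : ℝ | ∃ p₀ : X → ℝ, (∀ x, 0 ≤ p₀ x) ∧ (∑ x, p₀ x) = 1 ∧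
            d = ∑ x, ρ n (z₀ * p₀ x) (z₁ * p₁ x) (z₂ * p₂ x)})) :
    ∀ (n : ℕ) (z₀ z₁ z₂ : ℝ), 0 ≤ z₀ → 0 ≤ z₁ → 0 ≤ z₂ →
      ∃ k : ℕ, k ≤ n ∧
        Tendsto (fun h : ℝ => (ρ n (z₀ + h) z₁ z₂ - ρ n z₀ z₁ z₂) / h)
          (nhdsWithin 0 (Set.Ioi 0)) (nhds (k : ℝ)) := by
  have main : ∀ (n : ℕ) (z₁ z₂ : ℝ), 0 ≤ z₁ → 0 ≤ z₂ →
      ∃ (c : ℝ) (b : ℕ → ℝ), Antitone b ∧ (∀ j, 0 ≤ b j) ∧ ∀ t, 0 ≤ t →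
        ρ n t z₁ z₂ = c + ∑ j ∈ Finset.range n, min t (b j) := by
    intro n
    induction n with
    | zero =>
      intro z₁ z₂ _ _
      exact ⟨min (l₁ * z₁) (l₂ * z₂), fun _ => 0, antitone_const, fun _ => le_rfl,
        fun t _ => by simp [hρ0]⟩
    | succ n ih =>
      intro z₁ z₂ hz₁ hz₂
      choose c b hb hb0 hf using fun x => ih (z₁ * p₁ x) (z₂ * p₂ x)
        (mul_nonneg hz₁ (hp₁0 x)) (mul_nonneg hz₂ (hp₂0 x))
      obtain ⟨c', b', hb', hb0', h⟩ := exists_breakpoints_min_add (min (l₁ * z₁) (l₂ * z₂))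
        (∑ x, c x) n (fun j => ∑ x, b x j)
        (fun i j hij => Finset.sum_le_sum fun x _ => hb x hij)
        (fun j => Finset.sum_nonneg fun x _ => hb0 x j)
      refine ⟨c', b', hb', hb0', fun t ht => ?_⟩
      rw [← h t ht, hρrec n t z₁ z₂ ht hz₁ hz₂,
        (isGreatest_sum_allocation (fun x s => ρ n s (z₁ * p₁ x) (z₂ * p₂ x)) n c b hb hb0 hf
          t ht).csSup_eq]
  intro n z₀ z₁ z₂ hz₀ hz₁ hz₂
  obtain ⟨c, b, -, -, h⟩ := main n z₁ z₂ hz₁ hz₂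
  refine ⟨((Finset.range n).filter fun j => z₀ < b j).card,
    (Finset.card_filter_le _ _).trans_eq (Finset.card_range n), ?_⟩
  rw [Finset.natCast_card_filter]
  refine (tendsto_finsetSum (Finset.range n) fun j _ => tendsto_slope_min z₀ (b j)).congr' ?_
  filter_upwards [self_mem_nhdsWithin] with s hs
  have hs' : 0 < s := hs
  rw [h _ (by linarith), h _ hz₀, add_sub_add_left_eq_sub, ← Finset.sum_sub_distrib,
    Finset.sum_div]
end

section
/- The pointwise limit ρ := limₙ ρₙ satisfies ρ(0, z₁, z₂) = 0 for all z₁, z₂ ≥ 0. -/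
open MeasureTheory

lemma eq_of_half_add_sub_sqrt_mul_eq_zero {a b : ℝ} (ha : 0 ≤ a) (hb : 0 ≤ b)
    (h : (a + b) / 2 - √(a * b) = 0) : a = b := by
  have hs : √(a * b) * √(a * b) = a * b := Real.mul_self_sqrt (mul_nonneg ha hb)
  have hab : √(a * b) = (a + b) / 2 := by linarith
  rw [hab] at hs
  have : (a - b) ^ 2 = 0 := by linarith
  linarith [pow_eq_zero_iff (two_ne_zero) |>.mp this]

lemma sqrt_mul_le_half_add {a b : ℝ} (ha : 0 ≤ a) (hb : 0 ≤ b) : √(a * b) ≤ (a + b) / 2 :=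
  Real.sqrt_le_iff.mpr ⟨by linarith, by nlinarith [sq_nonneg (a - b)]⟩

lemma min_le_sqrt_mul {a b : ℝ} (ha : 0 ≤ a) (hb : 0 ≤ b) : min a b ≤ √(a * b) := by
  have hm : 0 ≤ min a b := le_min ha hb
  refine Real.le_sqrt_of_sq_le ?_
  rw [sq]
  exact mul_le_mul (min_le_left a b) (min_le_right a b) hm ha

section BhattacharyyaCoefficient

variable {X : Type*} [MeasurableSpace X] {μ : Measure X} {p q : X → ℝ}

lemma integrable_sqrt_mul (hp : Integrable p μ) (hq : Integrable q μ)
    (hp0 : ∀ x, 0 ≤ p x) (hq0 : ∀ x, 0 ≤ q x) : Integrable (fun x => √(p x * q x)) μ := by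
  refine ((hp.add hq).div_const 2).mono'
    (hp.aestronglyMeasurable.mul hq.aestronglyMeasurable).aemeasurable.sqrt.aestronglyMeasurable
    (.of_forall fun x => ?_)
  rw [Real.norm_of_nonneg (Real.sqrt_nonneg _)]
  exact sqrt_mul_le_half_add (hp0 x) (hq0 x)

/-- The Bhattacharyya coefficient of two distinct probability densities is less than one. -/
lemma integral_sqrt_mul_lt_one (hp0 : ∀ x, 0 ≤ p x) (hq0 : ∀ x, 0 ≤ q x)
    (hp1 : ∫ x, p x ∂μ = 1) (hq1 : ∫ x, q x ∂μ = 1) (hpq : 0 < μ {x | p x ≠ q x}) :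
    ∫ x, √(p x * q x) ∂μ < 1 := by
  have hp : Integrable p μ := .of_integral_ne_zero (by simp [hp1])
  have hq : Integrable q μ := .of_integral_ne_zero (by simp [hq1])
  have hs := integrable_sqrt_mul hp hq hp0 hq0
  have hm : Integrable (fun x => (p x + q x) / 2) μ := (hp.add hq).div_const 2
  have hnonneg : ∀ x, 0 ≤ (p x + q x) / 2 - √(p x * q x) := fun x =>
    sub_nonneg.mpr (sqrt_mul_le_half_add (hp0 x) (hq0 x))
  have hint : ∫ x, ((p x + q x) / 2 - √(p x * q x)) ∂μ = 1 - ∫ x, √(p x * q x) ∂μ := by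
    rw [integral_sub hm hs, integral_div, integral_add hp hq, hp1, hq1]
    norm_num
  by_contra! hle
  have hzero : ∫ x, ((p x + q x) / 2 - √(p x * q x)) ∂μ = 0 :=
    le_antisymm (by linarith) (integral_nonneg hnonneg)
  have hae := (integral_eq_zero_iff_of_nonneg hnonneg (hm.sub hs)).mp hzero
  refine hpq.ne' (ae_iff.mp (hae.mono fun x hx => ?_))
  exact eq_of_half_add_sub_sqrt_mul_eq_zero (hp0 x) (hq0 x) hx

end BhattacharyyaCoefficient

/-- The pointwise limit `ρ := limₙ ρₙ` satisfies `ρ(0, z₁, z₂) = 0` for all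
`z₁, z₂ ≥ 0`. -/
theorem rho_limit_zero_at_zero
    {X : Type*} [MeasurableSpace X] (μ : Measure X) [SigmaFinite μ]
    (p₁ p₂ : X → ℝ) (hp₁m : Measurable p₁) (hp₂m : Measurable p₂)
    (hp₁0 : ∀ x, 0 ≤ p₁ x) (hp₂0 : ∀ x, 0 ≤ p₂ x)
    (hp₁1 : ∫ x, p₁ x ∂μ = 1) (hp₂1 : ∫ x, p₂ x ∂μ = 1)
    (l₁ l₂ : ℝ) (hl₁ : 0 < l₁) (hl₂ : 0 < l₂)
    (ρ : ℕ → ℝ → ℝ → ℝ → ℝ)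
    (hρ0 : ∀ z₀ z₁ z₂ : ℝ, ρ 0 z₀ z₁ z₂ = min (l₁ * z₁) (l₂ * z₂))
    (hρrec : ∀ (n : ℕ) (z₀ z₁ z₂ : ℝ), 0 ≤ z₀ → 0 ≤ z₁ → 0 ≤ z₂ →
      ρ (n + 1) z₀ z₁ z₂ =
        min (min (l₁ * z₁) (l₂ * z₂))
          (z₀ + sSup {d : ℝ | ∃ p₀ : X → ℝ, Measurable p₀ ∧ (∀ x, 0 ≤ p₀ x) ∧
            (∫ x, p₀ x ∂μ) = 1 ∧
            d = ∫ x, ρ n (z₀ * p₀ x) (z₁ * p₁ x) (z₂ * p₂ x) ∂μ}))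
    (hdist : 0 < μ {x | p₁ x ≠ p₂ x})
    (ρlim : ℝ → ℝ → ℝ → ℝ)
    (hlim : ∀ (z₀ z₁ z₂ : ℝ), 0 ≤ z₀ → 0 ≤ z₁ → 0 ≤ z₂ →
      Filter.Tendsto (fun n : ℕ => ρ n z₀ z₁ z₂) Filter.atTop (nhds (ρlim z₀ z₁ z₂))) :
    ∀ (z₁ z₂ : ℝ), 0 ≤ z₁ → 0 ≤ z₂ → ρlim 0 z₁ z₂ = 0 := by
  have hp₁ : Integrable p₁ μ := .of_integral_ne_zero (by simp [hp₁1])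
  have hp₂ : Integrable p₂ μ := .of_integral_ne_zero (by simp [hp₂1])
  have hs := integrable_sqrt_mul hp₁ hp₂ hp₁0 hp₂0
  have hr1 := integral_sqrt_mul_lt_one hp₁0 hp₂0 hp₁1 hp₂1 hdist
  have hr0 : 0 ≤ ∫ x, √(p₁ x * p₂ x) ∂μ := integral_nonneg fun x => Real.sqrt_nonneg _
  set r := ∫ x, √(p₁ x * p₂ x) ∂μ with hr
  have hrec : ∀ n z₁ z₂, 0 ≤ z₁ → 0 ≤ z₂ → ρ (n + 1) 0 z₁ z₂ =
      min (min (l₁ * z₁) (l₂ * z₂)) (∫ x, ρ n 0 (z₁ * p₁ x) (z₂ * p₂ x) ∂μ) := by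
    intro n z₁ z₂ hz₁ hz₂
    have hset : {d : ℝ | ∃ p₀ : X → ℝ, Measurable p₀ ∧ (∀ x, 0 ≤ p₀ x) ∧
        (∫ x, p₀ x ∂μ) = 1 ∧ d = ∫ x, ρ n (0 * p₀ x) (z₁ * p₁ x) (z₂ * p₂ x) ∂μ} =
        {∫ x, ρ n 0 (z₁ * p₁ x) (z₂ * p₂ x) ∂μ} := by
      ext d
      simp only [zero_mul, Set.mem_ofPred_eq, Set.mem_singleton_iff]
      exact ⟨fun ⟨_, _, _, _, h⟩ => h, fun h => ⟨p₁, hp₁m, hp₁0, hp₁1, h⟩⟩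
    rw [hρrec n 0 z₁ z₂ le_rfl hz₁ hz₂, hset, csSup_singleton, zero_add]
  have hbound : ∀ n z₁ z₂, 0 ≤ z₁ → 0 ≤ z₂ → 0 ≤ ρ n 0 z₁ z₂ ∧
      ρ n 0 z₁ z₂ ≤ √(l₁ * l₂) * r ^ n * √(z₁ * z₂) := by
    intro n
    induction n with
    | zero =>
      intro z₁ z₂ hz₁ hz₂
      have h₁ := mul_nonneg hl₁.le hz₁
      have h₂ := mul_nonneg hl₂.le hz₂
      rw [hρ0, pow_zero, mul_one, ← Real.sqrt_mul (mul_nonneg hl₁.le hl₂.le),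
        mul_mul_mul_comm]
      exact ⟨le_min h₁ h₂, min_le_sqrt_mul h₁ h₂⟩
    | succ n ih =>
      intro z₁ z₂ hz₁ hz₂
      have ihx := fun x => ih (z₁ * p₁ x) (z₂ * p₂ x) (mul_nonneg hz₁ (hp₁0 x))
        (mul_nonneg hz₂ (hp₂0 x))
      rw [hrec n z₁ z₂ hz₁ hz₂]
      refine ⟨le_min (le_min (mul_nonneg hl₁.le hz₁) (mul_nonneg hl₂.le hz₂))
        (integral_nonneg fun x => (ihx x).1), (min_le_right _ _).trans ?_⟩
      calc ∫ x, ρ n 0 (z₁ * p₁ x) (z₂ * p₂ x) ∂μ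
          ≤ ∫ x, √(l₁ * l₂) * r ^ n * √(z₁ * z₂) * √(p₁ x * p₂ x) ∂μ := by
            refine integral_mono_of_nonneg (.of_forall fun x => (ihx x).1) (hs.const_mul _)
              (.of_forall fun x => (ihx x).2.trans_eq ?_)
            rw [mul_mul_mul_comm, Real.sqrt_mul (mul_nonneg hz₁ hz₂)]
            ring
        _ = √(l₁ * l₂) * r ^ (n + 1) * √(z₁ * z₂) := by
            rw [integral_const_mul, ← hr]
            ring
  intro z₁ z₂ hz₁ hz₂
  refine tendsto_nhds_unique (hlim 0 z₁ z₂ le_rfl hz₁ hz₂) ?_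
  refine squeeze_zero (fun n => (hbound n z₁ z₂ hz₁ hz₂).1)
    (fun n => (hbound n z₁ z₂ hz₁ hz₂).2) ?_
  simpa using ((tendsto_pow_atTop_nhds_zero_of_lt_one hr0 hr1).const_mul _).mul_const _
end
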